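/- arXiv:2502.04807 — 5 statements merged into one kernel-verified Lean document; each statement's English description precedes it below -/
import Mathlib

section
/- Let n ≥ 1 and let S_1, …, S_n, S_{n+1} be i.i.d. real-valued random variables on a probability space. Define the conformal p-value p̂ = (1 + #{i ∈ {1,…,n} : S_i ≥ S_{n+1}})/(n+1). Then for every α ∈ (0,1), the probability P(p̂ ≤ α) ≤ α. -/
open MeasureTheory

/-- The number of coordinates of `x` that are at least `x j`, the coordinate `j` included. -/
noncomputable def upperRank {ι : Type*} [Fintype ι] (x : ι → ℝ) (j : ι) : ℕ :=
  (Finset.univ.filter fun i => x j ≤ x i).card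

theorem upperRank_comp_equiv {ι : Type*} [Fintype ι] (x : ι → ℝ) (e : ι ≃ ι) (j : ι) :
    upperRank (x ∘ e) j = upperRank x (e j) :=
  Finset.card_equiv e fun i => by simp

theorem measurable_upperRank {ι : Type*} [Fintype ι] (j : ι) :
    Measurable fun x : ι → ℝ => upperRank x j := by
  simp only [upperRank, Finset.card_filter]
  refine Finset.measurable_sum _ fun i _ => ?_
  exact Measurable.ite (measurableSet_le (measurable_pi_apply j) (measurable_pi_apply i))
    measurable_const measurable_const

theorem measurableSet_upperRank_le {ι : Type*} [Fintype ι] (c : ℝ) (j : ι) :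
    MeasurableSet {x : ι → ℝ | (upperRank x j : ℝ) ≤ c} :=
  measurableSet_le (measurable_from_top.comp (measurable_upperRank j)) measurable_const

/-- At most `c` coordinates have upper rank at most `c`. -/
theorem card_upperRank_le {ι : Type*} [Fintype ι] (x : ι → ℝ) {c : ℝ} (hc : 0 ≤ c) :
    ((Finset.univ.filter fun j => (upperRank x j : ℝ) ≤ c).card : ℝ) ≤ c := by
  rcases (Finset.univ.filter fun j => (upperRank x j : ℝ) ≤ c).eq_empty_or_nonempty with h | h
  · simpa [h] using hc
  · obtain ⟨j, hj, hmin⟩ := Finset.exists_min_image _ x h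
    refine le_trans ?_ (Finset.mem_filter.mp hj).2
    exact_mod_cast Finset.card_le_card fun i hi =>
      Finset.mem_filter.mpr ⟨Finset.mem_univ i, hmin i hi⟩

theorem pi_upperRank_le_eq {ι : Type*} [Fintype ι] (μ : Measure ℝ) [SigmaFinite μ]
    (c : ℝ) (j k : ι) :
    Measure.pi (fun _ : ι => μ) {x | (upperRank x j : ℝ) ≤ c} =
      Measure.pi (fun _ : ι => μ) {x | (upperRank x k : ℝ) ≤ c} := by
  classical
  have hmp := measurePreserving_piCongrLeft (fun _ : ι => μ) (Equiv.swap j k)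
  rw [← hmp.measure_preimage (measurableSet_upperRank_le c j).nullMeasurableSet]
  congr 1
  ext x
  have hx : MeasurableEquiv.piCongrLeft (fun _ : ι => ℝ) (Equiv.swap j k) x =
      x ∘ Equiv.swap j k := by
    ext i
    obtain ⟨i, rfl⟩ := (Equiv.swap j k).surjective i
    rw [MeasurableEquiv.piCongrLeft_apply_apply]
    simp
  simp [hx, upperRank_comp_equiv]

theorem card_mul_pi_upperRank_le {ι : Type*} [Fintype ι] (μ : Measure ℝ)
    [IsProbabilityMeasure μ] {c : ℝ} (hc : 0 ≤ c) (k : ι) :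
    Fintype.card ι * Measure.pi (fun _ : ι => μ) {x | (upperRank x k : ℝ) ≤ c} ≤
      ENNReal.ofReal c := by
  set ν := Measure.pi fun _ : ι => μ
  calc Fintype.card ι * ν {x | (upperRank x k : ℝ) ≤ c}
      = ∑ j, ν {x | (upperRank x j : ℝ) ≤ c} := by
        rw [Finset.sum_congr rfl fun j _ => pi_upperRank_le_eq μ c j k]
        simp [ν]
    _ = ∫⁻ x, ∑ j, {x : ι → ℝ | (upperRank x j : ℝ) ≤ c}.indicator 1 x ∂ν := by
        rw [lintegral_finsetSum _ fun j _ =>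
          measurable_one.indicator (measurableSet_upperRank_le c j)]
        simp only [lintegral_indicator_one (measurableSet_upperRank_le c _)]
    _ ≤ ∫⁻ _, ENNReal.ofReal c ∂ν := by
        refine lintegral_mono fun x => ?_
        simp only [Set.indicator_apply, Set.mem_ofPred_eq, Pi.one_apply, Finset.sum_boole]
        rw [← ENNReal.ofReal_natCast]
        exact ENNReal.ofReal_le_ofReal (card_upperRank_le x hc)
    _ = ENNReal.ofReal c := by simp

theorem upperRank_last {n : ℕ} (x : Fin (n + 1) → ℝ) :
    upperRank x (Fin.last n) =
      1 + (Finset.univ.filter fun i : Fin n => x (Fin.last n) ≤ x i.castSucc).card := by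
  simp only [upperRank, Finset.card_filter, Fin.sum_univ_castSucc, le_refl, if_true, add_comm]

/-- upper bound of Proposition 2.1, Vovk.
Let `S 0, …, S n` be i.i.d. real random variables (the first `n` being
calibration scores and `S (Fin.last n)` the test score).  The conformal p-value
`p̂ = (1 + #{i ≤ n : S i ≥ S (n+1)}) / (n+1)` satisfies `P(p̂ ≤ α) ≤ α`
for every `α ∈ (0,1)`. -/
theorem conformal_pvalue_typeI_upper
    {Ω : Type*} [MeasurableSpace Ω] (P : Measure Ω) [IsProbabilityMeasure P]
    (n : ℕ) (hn : 1 ≤ n)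
    (μ : Measure ℝ) [IsProbabilityMeasure μ]
    (S : Fin (n + 1) → Ω → ℝ)
    (hmeas : ∀ i, Measurable (S i))
    (hiid : Measure.map (fun ω i => S i ω) P = Measure.pi fun _ : Fin (n + 1) => μ)
    (α : ℝ) (hα : α ∈ Set.Ioo (0 : ℝ) 1) :
    P {ω | (1 + ((Finset.univ.filter
          fun i : Fin n => S (Fin.last n) ω ≤ S i.castSucc ω).card : ℝ)) / (n + 1) ≤ α}
      ≤ ENNReal.ofReal α := by
  have hpos : (0 : ℝ) < n + 1 := by positivity
  have hset : {ω | (1 + ((Finset.univ.filter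
        fun i : Fin n => S (Fin.last n) ω ≤ S i.castSucc ω).card : ℝ)) / (n + 1) ≤ α} =
      (fun ω i => S i ω) ⁻¹' {x | (upperRank x (Fin.last n) : ℝ) ≤ α * (n + 1)} := by
    ext ω
    simp [upperRank_last, div_le_iff₀ hpos]
  rw [hset, ← Measure.map_apply (measurable_pi_lambda _ hmeas)
    (measurableSet_upperRank_le _ _), hiid]
  have hbound := card_mul_pi_upperRank_le μ (mul_nonneg hα.1.le hpos.le) (Fin.last n)
  have hcard : ENNReal.ofReal ((n : ℝ) + 1) = (Fintype.card (Fin (n + 1)) : ENNReal) := by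
    rw [← ENNReal.ofReal_natCast]
    simp
  rw [ENNReal.ofReal_mul hα.1.le, hcard, mul_comm] at hbound
  exact (ENNReal.mul_le_mul_iff_left (by simp) (ENNReal.natCast_ne_top _)).mp hbound
end

section
/- Let n ≥ 1 and let S_1, …, S_n, S_{n+1} be i.i.d. real-valued random variables whose common law is atomless (i.e., has a continuous distribution). Define the conformal p-value p̂ = (1 + #{i ∈ {1,…,n} : S_i ≥ S_{n+1}})/(n+1). Then for every α ∈ (0,1), the probability P(p̂ ≤ α) ≥ α − 1/(n+1). -/
open MeasureTheory

open ProbabilityTheory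

/-- The number of coordinates of `x` that are at least `x j`, the coordinate `j` included. -/
noncomputable def descRank {ι : Type*} [Fintype ι] (x : ι → ℝ) (j : ι) : ℕ :=
  (Finset.univ.filter fun i => x j ≤ x i).card

section descRank

variable {ι : Type*} [Fintype ι]

lemma descRank_lt_of_lt {x : ι → ℝ} {i j : ι} (h : x i < x j) :
    descRank x j < descRank x i := by
  refine Finset.card_lt_card (Finset.ssubset_iff_subset_ne.mpr ⟨?_, ?_⟩)
  · intro l hl
    simp only [Finset.mem_filter, Finset.mem_univ, true_and] at hl ⊢
    exact h.le.trans hl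
  · intro he
    have hi := Finset.ext_iff.mp he i
    simp only [Finset.mem_filter, Finset.mem_univ, true_and, le_refl, iff_true] at hi
    exact absurd h (not_lt.mpr hi)

lemma descRank_injective {x : ι → ℝ} (hx : Function.Injective x) :
    Function.Injective (descRank x) := by
  intro i j hij
  by_contra hne
  rcases lt_or_gt_of_ne (hx.ne hne) with h | h
  · exact (descRank_lt_of_lt h).ne' hij
  · exact (descRank_lt_of_lt h).ne hij

lemma le_card_descRank_le {x : ι → ℝ} (hx : Function.Injective x) {k : ℕ}
    (hk : k ≤ Fintype.card ι) :
    k ≤ (Finset.univ.filter fun j => descRank x j ≤ k).card := by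
  have hsplit := Finset.card_filter_add_card_filter_not (s := (Finset.univ : Finset ι))
    (fun j => descRank x j ≤ k)
  have hle : (Finset.univ.filter fun j => ¬ descRank x j ≤ k).card
      ≤ (Finset.Ioc k (Fintype.card ι)).card := by
    refine Finset.card_le_card_of_injOn (descRank x) ?_ (descRank_injective hx).injOn
    intro j hj
    have hj' : k < descRank x j := by simpa using hj
    exact Finset.mem_coe.mpr (Finset.mem_Ioc.mpr ⟨hj', Finset.card_le_univ _⟩)
  rw [Nat.card_Ioc] at hle
  rw [Finset.card_univ] at hsplit
  omega

lemma descRank_comp_equiv (x : ι → ℝ) (e : ι ≃ ι) (j : ι) :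
    descRank (x ∘ e) j = descRank x (e j) := by
  refine Finset.card_bij (fun i _ => e i) ?_ ?_ ?_
  · intro i hi
    simpa using hi
  · intro a _ b _ h
    exact e.injective h
  · intro b hb
    exact ⟨e.symm b, by simpa using hb, by simp⟩

lemma measurable_descRank (j : ι) : Measurable fun x : ι → ℝ => descRank x j := by
  simp only [descRank, Finset.card_filter]
  exact Finset.measurable_fun_sum _ fun i _ => Measurable.ite
    (measurableSet_le (measurable_pi_apply j) (measurable_pi_apply i))
    measurable_const measurable_const

lemma measurableSet_descRank_le (j : ι) (k : ℕ) :
    MeasurableSet {x : ι → ℝ | descRank x j ≤ k} :=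
  measurable_descRank j measurableSet_Iic

variable (μ : Measure ℝ) [IsProbabilityMeasure μ]

lemma pi_descRank_le_eq (i j : ι) (k : ℕ) :
    Measure.pi (fun _ : ι => μ) {x | descRank x i ≤ k}
      = Measure.pi (fun _ : ι => μ) {x | descRank x j ≤ k} := by
  classical
  have hmp := measurePreserving_piCongrLeft (fun _ : ι => μ) (Equiv.swap i j)
  rw [← hmp.measure_preimage (measurableSet_descRank_le i k).nullMeasurableSet]
  congr 1
  ext x
  have hx : MeasurableEquiv.piCongrLeft (fun _ : ι => ℝ) (Equiv.swap i j) x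
      = x ∘ Equiv.swap i j := by
    ext l
    obtain ⟨m, rfl⟩ := (Equiv.swap i j).surjective l
    rw [MeasurableEquiv.piCongrLeft_apply_apply]
    simp
  simp only [Set.mem_preimage, Set.mem_ofPred_eq, hx, descRank_comp_equiv, Equiv.swap_apply_left]

lemma ae_pi_injective (hμ : ∀ x : ℝ, μ {x} = 0) :
    ∀ᵐ x ∂Measure.pi (fun _ : ι => μ), Function.Injective x := by
  have hne : ∀ i j : ι, i ≠ j → ∀ᵐ x ∂Measure.pi (fun _ : ι => μ), x i ≠ x j := by
    intro i j hij
    have hindep : IndepFun (fun x : ι → ℝ => x i) (fun x : ι → ℝ => x j)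
        (Measure.pi fun _ : ι => μ) :=
      (iIndepFun_pi (μ := fun _ : ι => μ) (X := fun _ y => y)
        fun _ => aemeasurable_id).indepFun hij
    have hmap := (indepFun_iff_map_prod_eq_prod_map_map (measurable_pi_apply i).aemeasurable
      (measurable_pi_apply j).aemeasurable).mp hindep
    have hev : ∀ l : ι, (Measure.pi fun _ : ι => μ).map (fun x => x l) = μ := fun l =>
      (measurePreserving_eval (fun _ : ι => μ) l).map_eq
    rw [hev, hev] at hmap
    have hdiag : (μ.prod μ) {p : ℝ × ℝ | p.1 = p.2} = 0 := by
      rw [Measure.measure_prod_null (measurableSet_eq_fun measurable_fst measurable_snd)]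
      refine Filter.Eventually.of_forall fun x => ?_
      have hset : Prod.mk x ⁻¹' {p : ℝ × ℝ | p.1 = p.2} = {x} := by
        ext y
        simp [eq_comm]
      simp [hset, hμ]
    rw [← hmap, Measure.map_apply ((measurable_pi_apply i).prodMk (measurable_pi_apply j))
      (measurableSet_eq_fun measurable_fst measurable_snd)] at hdiag
    simpa [ae_iff] using hdiag
  have hall : ∀ᵐ x ∂Measure.pi (fun _ : ι => μ), ∀ i j : ι, i ≠ j → x i ≠ x j := by
    simp only [ae_all_iff]
    exact hne
  filter_upwards [hall] with x hx i j hij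
  by_contra h
  exact hx i j h hij

lemma le_card_mul_pi_descRank_le (hμ : ∀ x : ℝ, μ {x} = 0) (j : ι) {k : ℕ}
    (hk : k ≤ Fintype.card ι) :
    (k : ENNReal) ≤ Fintype.card ι * Measure.pi (fun _ : ι => μ) {x | descRank x j ≤ k} := by
  have hsum : (∑ i : ι, Measure.pi (fun _ : ι => μ) {x | descRank x i ≤ k})
      = Fintype.card ι * Measure.pi (fun _ : ι => μ) {x | descRank x j ≤ k} := by
    rw [Finset.sum_congr rfl fun i _ => pi_descRank_le_eq μ i j k]
    simp
  rw [← hsum]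
  calc (k : ENNReal) = ∫⁻ _, (k : ENNReal) ∂Measure.pi (fun _ : ι => μ) := by simp
    _ ≤ ∫⁻ x, ∑ i : ι, {x : ι → ℝ | descRank x i ≤ k}.indicator 1 x
          ∂Measure.pi (fun _ : ι => μ) := by
        refine lintegral_mono_ae ?_
        filter_upwards [ae_pi_injective μ hμ] with x hx
        have hcard := le_card_descRank_le hx hk
        simp only [Set.indicator_apply, Set.mem_ofPred_eq, Pi.one_apply, Finset.sum_boole]
        exact_mod_cast hcard
    _ = ∑ i : ι, Measure.pi (fun _ : ι => μ) {x | descRank x i ≤ k} := by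
        rw [lintegral_finsetSum _ fun i _ =>
          measurable_one.indicator (measurableSet_descRank_le i k)]
        exact Finset.sum_congr rfl fun i _ =>
          lintegral_indicator_one (measurableSet_descRank_le i k)

end descRank

lemma descRank_last {n : ℕ} (x : Fin (n + 1) → ℝ) :
    descRank x (Fin.last n)
      = 1 + (Finset.univ.filter fun i : Fin n => x (Fin.last n) ≤ x i.castSucc).card := by
  simp only [descRank, Finset.card_filter, Fin.sum_univ_castSucc, le_refl, if_true]
  exact add_comm _ _

/-- lower bound of Proposition 2.1, Vovk.
Let `S 0, …, S n` be i.i.d. real random variables with an atomless common law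
(i.e., a continuous distribution).  The conformal p-value
`p̂ = (1 + #{i ≤ n : S i ≥ S (n+1)}) / (n+1)` satisfies
`P(p̂ ≤ α) ≥ α − 1/(n+1)` for every `α ∈ (0,1)`. -/
theorem conformal_pvalue_typeI_lower
    {Ω : Type*} [MeasurableSpace Ω] (P : Measure Ω) [IsProbabilityMeasure P]
    (n : ℕ) (hn : 1 ≤ n)
    (μ : Measure ℝ) [IsProbabilityMeasure μ]
    (hatomless : ∀ x : ℝ, μ {x} = 0)
    (S : Fin (n + 1) → Ω → ℝ)
    (hmeas : ∀ i, Measurable (S i))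
    (hiid : Measure.map (fun ω i => S i ω) P = Measure.pi fun _ : Fin (n + 1) => μ)
    (α : ℝ) (hα : α ∈ Set.Ioo (0 : ℝ) 1) :
    ENNReal.ofReal (α - 1 / (n + 1))
      ≤ P {ω | (1 + ((Finset.univ.filter
          fun i : Fin n => S (Fin.last n) ω ≤ S i.castSucc ω).card : ℝ)) / (n + 1) ≤ α} := by
  obtain ⟨hα0, hα1⟩ := hα
  have hn0 : (0 : ℝ) < n + 1 := by positivity
  set k := ⌊α * (n + 1)⌋₊ with hkdef
  have hkle : (k : ℝ) ≤ α * (n + 1) := Nat.floor_le (by positivity)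
  have hklt : α * (n + 1) < k + 1 := Nat.lt_floor_add_one _
  have hk : k ≤ Fintype.card (Fin (n + 1)) := by
    rw [Fintype.card_fin]
    have : (k : ℝ) ≤ ((n + 1 : ℕ) : ℝ) := by
      push_cast
      nlinarith
    exact_mod_cast this
  have hmain := le_card_mul_pi_descRank_le μ hatomless (Fin.last n) hk
  rw [← hiid, Measure.map_apply (measurable_pi_lambda _ hmeas)
    (measurableSet_descRank_le (Fin.last n) k), Fintype.card_fin] at hmain
  have hsub : (fun ω i => S i ω) ⁻¹' {x | descRank x (Fin.last n) ≤ k}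
      ⊆ {ω | (1 + ((Finset.univ.filter
          fun i : Fin n => S (Fin.last n) ω ≤ S i.castSucc ω).card : ℝ)) / (n + 1) ≤ α} := by
    intro ω hω
    simp only [Set.mem_preimage, Set.mem_ofPred_eq, descRank_last] at hω ⊢
    rw [div_le_iff₀ hn0]
    refine le_trans ?_ hkle
    exact_mod_cast hω
  refine le_trans ?_ (measure_mono hsub)
  have hdiv : ENNReal.ofReal (k / (n + 1))
      ≤ P ((fun ω i => S i ω) ⁻¹' {x | descRank x (Fin.last n) ≤ k}) := by
    rw [ENNReal.ofReal_div_of_pos hn0, ENNReal.ofReal_natCast]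
    refine ENNReal.div_le_of_le_mul' ?_
    have hcast : ENNReal.ofReal ((n : ℝ) + 1) = ((n + 1 : ℕ) : ENNReal) := by
      rw [← ENNReal.ofReal_natCast]
      push_cast
      rfl
    rwa [hcast]
  refine le_trans (ENNReal.ofReal_le_ofReal ?_) hdiv
  rw [le_div_iff₀ hn0, sub_mul, one_div, inv_mul_cancel₀ hn0.ne']
  linarith
end

section
/- Fix integers n_0 ≥ 0 and n_1 ≥ 1, set n = n_0 + n_1, and fix α ∈ (0,1). Let μ_0 and μ_1 be atomless Borel probability measures on ℝ. Let S_1, …, S_{n_0} be i.i.d. with law μ_0 (inlier calibration scores), let S_{n_0+1}, …, S_n be i.i.d. with law μ_1 (outlier calibration scores), and let S_{n+1} have law μ_0 (the null test score), all n+1 variables being mutually independent. Let p̂ = (1 + #{i ∈ {1,…,n} : S_i ≥ S_{n+1}})/(n+1) be the conformal p-value, let Q̂ be the ⌈(1−α)(n+1)⌉-th smallest element of the multiset {S_1, …, S_n} ∪ {+∞} in [−∞,+∞], and let F̂_1(t) = (1/n_1)·#{j ∈ {n_0+1,…,n} : S_j ≤ t} for t ∈ [−∞,+∞] (the empirical CDF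 of the outlier scores, with F̂_1(+∞) = 1). Then P(p̂ ≤ α) ≤ α − (n_1/(n_0+1))·(1 − α − E[F̂_1(Q̂)]). -/
open MeasureTheory

/-- The `k`-th smallest element (1-indexed) of a finite multiset of extended reals,
i.e. the `k`-th entry when the elements are listed in nondecreasing order
(counted with multiplicity). -/
noncomputable def kthSmallestE (A : Multiset EReal) (k : ℕ) : EReal :=
  (A.sort (· ≤ ·)).getD (k - 1) 0

/-- The entry of index `m` of a sorted list is below `x` iff more than `m` entries are. -/
theorem List.SortedLE.getElem_lt_iff_lt_countP {β : Type*} [LinearOrder β] {l : List β}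
    (hl : l.SortedLE) {m : ℕ} (hm : m < l.length) (x : β) :
    l[m] < x ↔ m < l.countP (· < x) := by
  constructor
  · intro h
    have hall : (l.take (m + 1)).countP (· < x) = (l.take (m + 1)).length := by
      rw [List.countP_eq_length]
      intro a ha
      obtain ⟨i, hi, rfl⟩ := List.mem_take_iff_getElem.mp ha
      have : l[i] ≤ l[m] := hl.getElem_le_getElem_of_le (by omega)
      simpa using this.trans_lt h
    have hle := (List.take_sublist (m + 1) l).countP_le (p := fun a => decide (a < x))
    rw [hall, List.length_take] at hle
    omega
  · intro h
    by_contra hx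
    have hzero : (l.drop m).countP (· < x) = 0 := by
      rw [List.countP_eq_zero]
      intro a ha
      obtain ⟨i, hi, rfl⟩ := List.mem_drop_iff_getElem.mp ha
      have : l[m] ≤ l[m + i] := hl.getElem_le_getElem_of_le (by omega)
      simpa using (not_lt.mp hx).trans this
    have hsplit : l.countP (· < x) = (l.take m).countP (· < x) + (l.drop m).countP (· < x) := by
      rw [← List.countP_append, List.take_append_drop]
    have hle := List.countP_le_length (p := fun a => decide (a < x)) (l := l.take m)
    rw [List.length_take] at hle
    omega

theorem kthSmallestE_lt_iff {A : Multiset EReal} {k : ℕ} (hk : 1 ≤ k) (hkA : k ≤ A.card)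
    (x : EReal) : kthSmallestE A k < x ↔ k ≤ A.countP (· < x) := by
  have hm : k - 1 < (A.sort (· ≤ ·)).length := by
    rw [Multiset.length_sort]
    omega
  have hcount : A.countP (· < x) = (A.sort (· ≤ ·)).countP (· < x) := by
    conv_lhs => rw [← Multiset.sort_eq A (· ≤ ·)]
    exact Multiset.coe_countP _ _
  have hsorted : (A.sort (· ≤ ·)).SortedLE := (Multiset.pairwise_sort A (· ≤ ·)).sortedLE
  rw [kthSmallestE, List.getD_eq_getElem _ _ hm, hsorted.getElem_lt_iff_lt_countP hm, hcount]
  omega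

/-- At most `|ι| - k` entries of a finite family have at least `k` entries strictly below them. -/
theorem card_filter_le_card_filter_lt_add_le {ι β : Type*} [Fintype ι] [LinearOrder β]
    (x : ι → β) {k : ℕ} (hk : k ≤ Fintype.card ι) :
    (Finset.univ.filter fun i => k ≤ (Finset.univ.filter fun l => x l < x i).card).card + k
      ≤ Fintype.card ι := by
  classical
  set B := Finset.univ.filter fun i => k ≤ (Finset.univ.filter fun l => x l < x i).card with hB
  rcases B.eq_empty_or_nonempty with h | h
  · simpa [h] using hk
  · obtain ⟨i, hi, hmin⟩ := B.exists_min_image x h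
    have hki : k ≤ (Finset.univ.filter fun l => x l < x i).card := (Finset.mem_filter.mp hi).2
    have hdisj : Disjoint B (Finset.univ.filter fun l => x l < x i) := by
      rw [Finset.disjoint_left]
      intro l hl hl'
      exact (hmin l hl).not_gt (Finset.mem_filter.mp hl').2
    calc B.card + k ≤ B.card + (Finset.univ.filter fun l => x l < x i).card := by omega
      _ = (B ∪ Finset.univ.filter fun l => x l < x i).card :=
        (Finset.card_union_of_disjoint hdisj).symm
      _ ≤ Fintype.card ι := Finset.card_le_univ _

theorem measurableSet_le_card_filter_lt {Ω ι : Type*} [MeasurableSpace Ω] [Fintype ι]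
    {X : ι → Ω → ℝ} (hX : ∀ i, Measurable (X i)) {Y : Ω → ℝ} (hY : Measurable Y) (k : ℕ) :
    MeasurableSet {ω | k ≤ (Finset.univ.filter fun l => X l ω < Y ω).card} := by
  have hcard : Measurable fun ω => (Finset.univ.filter fun l => X l ω < Y ω).card := by
    simp only [Finset.card_filter]
    exact Finset.measurable_sum _ fun l _ =>
      Measurable.ite (measurableSet_lt (hX l) hY) measurable_const measurable_const
  exact measurableSet_le measurable_const hcard

/-- Under a product measure, coordinates with equal laws have the same rank distribution. -/
theorem measure_pi_rank_eq {ι : Type*} [Fintype ι] (ν : ι → Measure ℝ)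
    [∀ i, SigmaFinite (ν i)] {i j : ι} (hij : ν i = ν j) (k : ℕ) :
    Measure.pi ν {x | k ≤ (Finset.univ.filter fun l => x l < x i).card}
      = Measure.pi ν {x | k ≤ (Finset.univ.filter fun l => x l < x j).card} := by
  classical
  have hν : (fun l => ν (Equiv.swap i j l)) = ν := by
    funext l
    rcases eq_or_ne l i with rfl | hi
    · simp [hij]
    rcases eq_or_ne l j with rfl | hj
    · simp [hij]
    rw [Equiv.swap_apply_of_ne_of_ne hi hj]
  have hmp := measurePreserving_piCongrLeft ν (Equiv.swap i j)
  rw [hν] at hmp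
  have happ : ∀ (x : ι → ℝ) (l : ι),
      MeasurableEquiv.piCongrLeft (fun _ => ℝ) (Equiv.swap i j) x l = x (Equiv.swap i j l) := by
    intro x l
    have := Equiv.piCongrLeft_apply_apply (fun _ : ι => ℝ) (Equiv.swap i j) x (Equiv.swap i j l)
    rwa [Equiv.swap_apply_self] at this
  rw [← hmp.measure_preimage (measurableSet_le_card_filter_lt (fun l => measurable_pi_apply l)
    (measurable_pi_apply i) k).nullMeasurableSet]
  congr 1
  ext x
  simp only [Set.mem_preimage, Set.mem_ofPred_eq, happ, Equiv.swap_apply_left]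
  rw [Finset.card_equiv (Equiv.swap i j) (t := Finset.univ.filter fun l => x l < x j)]
  simp

/-- The expected number of entries with at least `k` entries strictly below them. -/
theorem sum_measureReal_rank_le {Ω ι : Type*} [MeasurableSpace Ω] (P : Measure Ω)
    [IsProbabilityMeasure P] [Fintype ι] {X : ι → Ω → ℝ} (hX : ∀ i, Measurable (X i))
    {k : ℕ} (hk : k ≤ Fintype.card ι) :
    ∑ i, P.real {ω | k ≤ (Finset.univ.filter fun l => X l ω < X i ω).card}
      ≤ Fintype.card ι - k := by
  have hm := fun i => measurableSet_le_card_filter_lt hX (hX i) k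
  have hint : ∀ i ∈ Finset.univ, Integrable
      ({ω | k ≤ (Finset.univ.filter fun l => X l ω < X i ω).card}.indicator (1 : Ω → ℝ)) P :=
    fun i _ => (integrable_const (1 : ℝ)).indicator (hm i)
  calc ∑ i, P.real {ω | k ≤ (Finset.univ.filter fun l => X l ω < X i ω).card}
      = ∫ ω, ∑ i, {ω | k ≤ (Finset.univ.filter fun l => X l ω < X i ω).card}.indicator
          (1 : Ω → ℝ) ω ∂P := by
        rw [integral_finsetSum _ hint]
        exact Finset.sum_congr rfl fun i _ => (integral_indicator_one (hm i)).symm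
    _ ≤ ∫ _, ((Fintype.card ι : ℝ) - k) ∂P := by
        refine integral_mono (integrable_finsetSum _ hint) (integrable_const _) fun ω => ?_
        have h := card_filter_le_card_filter_lt_add_le (fun i => X i ω) hk
        rw [Finset.card_filter] at h
        have h' := (Nat.cast_le (α := ℝ)).mpr h
        push_cast at h'
        simp only [Set.indicator_apply, Set.mem_ofPred_eq, Pi.one_apply]
        linarith
    _ = Fintype.card ι - k := by simp

theorem integral_card_filter_div {Ω ι : Type*} [MeasurableSpace Ω] (P : Measure Ω)
    [IsProbabilityMeasure P] (s : Finset ι) {E : ι → Set Ω} (hE : ∀ i, MeasurableSet (E i))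
    [∀ ω, DecidablePred fun i => ω ∉ E i] (c : ℝ) :
    ∫ ω, ((s.filter fun i => ω ∉ E i).card : ℝ) / c ∂P = (s.card - ∑ i ∈ s, P.real (E i)) / c := by
  have hcard : ∀ ω, ((s.filter fun i => ω ∉ E i).card : ℝ)
      = ∑ i ∈ s, (E i)ᶜ.indicator (1 : Ω → ℝ) ω := by
    intro ω
    simp only [Finset.card_filter, Nat.cast_sum, Nat.cast_ite, Nat.cast_one, Nat.cast_zero]
    exact Finset.sum_congr rfl fun i _ => by congr
  simp only [hcard]
  have hint : ∀ i ∈ s, Integrable ((E i)ᶜ.indicator (1 : Ω → ℝ)) P := fun i _ =>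
    (integrable_const (1 : ℝ)).indicator (hE i).compl
  rw [integral_div, integral_finsetSum _ hint]
  simp only [integral_indicator_one (hE _).compl, probReal_compl_eq_one_sub (hE _)]
  simp

/-- The conformal p-value is at most `α` iff the test score exceeds at least `⌈(1-α)(n+1)⌉`
calibration scores. -/
theorem conformal_pvalue_le_iff {n : ℕ} (x : Fin (n + 1) → ℝ) (α : ℝ) :
    (1 + ((Finset.univ.filter fun i : Fin n => x (Fin.last n) ≤ x i.castSucc).card : ℝ)) / (n + 1)
        ≤ α ↔
      ⌈(1 - α) * (n + 1)⌉₊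
        ≤ (Finset.univ.filter fun l : Fin (n + 1) => x l < x (Fin.last n)).card := by
  have hlt : (Finset.univ.filter fun l : Fin (n + 1) => x l < x (Fin.last n)).card
      = (Finset.univ.filter fun i : Fin n => x i.castSucc < x (Fin.last n)).card := by
    simp only [Finset.card_filter, Fin.sum_univ_castSucc, lt_irrefl, if_false, add_zero]
  have hadd := Finset.card_filter_add_card_filter_not (s := (Finset.univ : Finset (Fin n)))
    (fun i => x i.castSucc < x (Fin.last n))
  simp only [not_lt, Finset.card_univ, Fintype.card_fin] at hadd
  have hadd' := congrArg (Nat.cast (R := ℝ)) hadd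
  push_cast at hadd'
  rw [Nat.ceil_le, hlt, div_le_iff₀ (by positivity)]
  constructor <;> intro h <;> linarith

/-- (Lemma 3.1: conservativeness of standard conformal p-values
calibrated on a contaminated reference set with `n₀` inliers (law `μ0`) and
`n₁` outliers (law `μ1`), all scores mutually independent and the test score
having the inlier law `μ0`).  With `Q̂` the `⌈(1−α)(n+1)⌉`-th smallest element of
the calibration scores together with `+∞`, and `F̂₁` the empirical CDF of the
outlier scores, `P(p̂ ≤ α) ≤ α − (n₁/(n₀+1))·(1 − α − E[F̂₁(Q̂)])`. -/
theorem contaminated_conformal_conservative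
    {Ω : Type*} [MeasurableSpace Ω] (P : Measure Ω) [IsProbabilityMeasure P]
    (n0 n1 : ℕ) (hn1 : 1 ≤ n1)
    (μ0 μ1 : Measure ℝ) [IsProbabilityMeasure μ0] [IsProbabilityMeasure μ1]
    (h0 : ∀ x : ℝ, μ0 {x} = 0) (h1 : ∀ x : ℝ, μ1 {x} = 0)
    (S : Fin (n0 + n1 + 1) → Ω → ℝ)
    (hmeas : ∀ i, Measurable (S i))
    (hlaw : Measure.map (fun ω i => S i ω) P
      = Measure.pi fun i : Fin (n0 + n1 + 1) =>
          if i.val < n0 ∨ i.val = n0 + n1 then μ0 else μ1)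
    (α : ℝ) (hα : α ∈ Set.Ioo (0 : ℝ) 1) :
    (P {ω | (1 + ((Finset.univ.filter
          fun i : Fin (n0 + n1) =>
            S (Fin.last (n0 + n1)) ω ≤ S i.castSucc ω).card : ℝ)) / (n0 + n1 + 1) ≤ α}).toReal
      ≤ α - ((n1 : ℝ) / (n0 + 1)) * (1 - α -
          ∫ ω, ((Finset.univ.filter
              fun j : Fin (n0 + n1) =>
                n0 ≤ j.val ∧ ((S j.castSucc ω : ℝ) : EReal) ≤
                  kthSmallestE
                    ((⊤ : EReal) ::ₘ (Finset.univ.val.map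
                      fun i : Fin (n0 + n1) => ((S i.castSucc ω : ℝ) : EReal)))
                    ⌈(1 - α) * (n0 + n1 + 1)⌉₊).card : ℝ) / (n1 : ℝ) ∂P) := by
  set k := ⌈(1 - α) * (n0 + n1 + 1 : ℝ)⌉₊ with hk
  obtain ⟨hα0, hα1⟩ := hα
  have hk1 : 1 ≤ k := Nat.ceil_pos.mpr (mul_pos (by linarith) (by positivity))
  have hkN : k ≤ n0 + n1 + 1 := by
    rw [hk, Nat.ceil_le]
    push_cast
    have : (0 : ℝ) ≤ α * (n0 + n1 + 1) := by positivity
    linarith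
  have hkα : (1 - α) * (n0 + n1 + 1 : ℝ) ≤ k := Nat.le_ceil _
  let B (i : Fin (n0 + n1 + 1)) : Set Ω :=
    {ω | k ≤ (Finset.univ.filter fun l => S l ω < S i ω).card}
  let E (j : Fin (n0 + n1)) : Set Ω :=
    {ω | k ≤ (Finset.univ.filter fun l : Fin (n0 + n1) => S l.castSucc ω < S j.castSucc ω).card}
  have hE : ∀ j, MeasurableSet (E j) := fun j =>
    measurableSet_le_card_filter_lt (X := fun l : Fin (n0 + n1) => S l.castSucc)
      (fun l => hmeas l.castSucc) (hmeas j.castSucc) k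
  have hEB : ∀ j, P.real (E j) ≤ P.real (B j.castSucc) := by
    refine fun j => measureReal_mono fun ω hω => le_trans (show k ≤ _ from hω) ?_
    simp only [Finset.card_filter, Fin.sum_univ_castSucc]
    omega
  have hevent : {ω | (1 + ((Finset.univ.filter fun i : Fin (n0 + n1) =>
      S (Fin.last (n0 + n1)) ω ≤ S i.castSucc ω).card : ℝ)) / (n0 + n1 + 1) ≤ α}
      = B (Fin.last (n0 + n1)) := by
    ext ω
    have := conformal_pvalue_le_iff (fun i => S i ω) α
    push_cast at this
    exact this
  have hswap : ∀ j : Fin (n0 + n1), ¬ n0 ≤ j.val →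
      P.real (B j.castSucc) = P.real (B (Fin.last (n0 + n1))) := by
    intro j hj
    have hmap : ∀ i, P (B i) = (Measure.map (fun ω i => S i ω) P)
        {x | k ≤ (Finset.univ.filter fun l => x l < x i).card} := fun i =>
      (Measure.map_apply (measurable_pi_lambda _ hmeas) (measurableSet_le_card_filter_lt
        (fun l => measurable_pi_apply l) (measurable_pi_apply i) k)).symm
    have : ∀ i : Fin (n0 + n1 + 1),
        SigmaFinite (if i.val < n0 ∨ i.val = n0 + n1 then μ0 else μ1) := by
      intro i
      split_ifs <;> infer_instance
    rw [measureReal_def, measureReal_def, hmap, hmap, hlaw]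
    congr 1
    refine measure_pi_rank_eq _ ?_ k
    simp [not_le.mp hj]
  have hQ : ∀ ω (j : Fin (n0 + n1)), ((S j.castSucc ω : ℝ) : EReal) ≤ kthSmallestE
      ((⊤ : EReal) ::ₘ (Finset.univ.val.map
        fun i : Fin (n0 + n1) => ((S i.castSucc ω : ℝ) : EReal))) k ↔ ω ∉ E j := by
    intro ω j
    rw [← not_lt, kthSmallestE_lt_iff hk1 (by simpa using hkN)]
    rw [Multiset.countP_cons_of_neg (p := (· < ((S j.castSucc ω : ℝ) : EReal))) _ not_top_lt,
      Multiset.countP_map]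
    simp only [EReal.coe_lt_coe_iff]
    rfl
  have hO : (Finset.univ.filter fun j : Fin (n0 + n1) => n0 ≤ j.val).card = n1 := by
    rw [Finset.card_filter, Fin.sum_univ_add]
    simp
  have hI : (Finset.univ.filter fun j : Fin (n0 + n1) => ¬ n0 ≤ j.val).card = n0 := by
    rw [Finset.card_filter, Fin.sum_univ_add]
    simp
  have hsum := sum_measureReal_rank_le P hmeas (k := k) (by simpa using hkN)
  change ∑ i, P.real (B i) ≤ _ at hsum
  rw [Fin.sum_univ_castSucc, ← Finset.sum_filter_add_sum_filter_not Finset.univ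
      (fun j : Fin (n0 + n1) => n0 ≤ j.val),
    Finset.sum_congr rfl fun j hj => hswap j (Finset.mem_filter.mp hj).2, Finset.sum_const, hI,
    nsmul_eq_mul, Fintype.card_fin] at hsum
  push_cast at hsum
  have hout := Finset.sum_le_sum fun j
    (_ : j ∈ Finset.univ.filter fun j : Fin (n0 + n1) => n0 ≤ j.val) => hEB j
  classical
  have hint := integral_card_filter_div P
    (Finset.univ.filter fun j : Fin (n0 + n1) => n0 ≤ j.val) hE n1
  rw [hO] at hint
  simp only [Finset.filter_filter] at hint
  rw [hevent]
  simp only [hQ]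
  rw [← measureReal_def]
  have hn1' : (0 : ℝ) < n1 := by exact_mod_cast hn1
  have key : ((n0 : ℝ) + 1) * P.real (B (Fin.last (n0 + n1))) ≤ α * (n0 + n1 + 1) -
      ∑ j ∈ Finset.univ.filter fun j : Fin (n0 + n1) => n0 ≤ j.val, P.real (E j) := by
    linarith
  convert_to _ ≤ α - ((n1 : ℝ) / (n0 + 1)) * (1 - α - (n1 -
    ∑ j ∈ Finset.univ.filter fun j : Fin (n0 + n1) => n0 ≤ j.val, P.real (E j)) / n1)
  · rw [← hint]
  rw [← le_div_iff₀' (by positivity)] at key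
  refine key.trans_eq ?_
  field_simp
  ring
end

section
/- Fix integers n_0 ≥ 0, n_1 ≥ 1, set n = n_0 + n_1, fix a budget m with 1 ≤ m ≤ n, and fix α ∈ (0,1) with m ≤ α(n+1). Let μ_0 and μ_1 be atomless Borel probability measures on ℝ. Let S_1, …, S_{n_0} be i.i.d. with law μ_0 (inlier calibration scores), let S_{n_0+1}, …, S_n be i.i.d. with law μ_1 (outlier calibration scores), and let S_{n+1} have law μ_0 (the null test score), all n+1 variables being mutually independent. Since the scores are almost surely pairwise distinct, let T ⊆ {1,…,n} be the set of the m indices with the largest calibration scores (breaking ties by index on the null event of ties), and let the label-trimmed calibration set be D^LT = {i ∈ {1,…,n} : i ∉ T} ∪ {i ∈ T : i ≤ n_0}. Set n^LT = |D^LT| and define the trimmed conformal p-value p̂^LT = (1 + #{i ∈ D^LT : S_i ≥ S_{n+1}})/(n^LT + 1). Let Q̂^LT be the ⌈(1−α)(n^LT+1)⌉-th smallest element of the multiset {S_i : i ∈ D^LT} ∪ {+∞} in [−∞,+∞], let n̂_1^LT = #{i ∈ D^LT : i > n_0} be the number of outliers remaining after trimming, and let N^LT = #{i ∈ D^LT :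 i > n_0 and S_i ≤ Q̂^LT}. Then P(p̂^LT ≤ α) ≤ α + 1/(n_0+1) − (1/(n_0+1))·E[ n̂_1^LT·(1−α) − N^LT ]. -/
open MeasureTheory

/-- The set `T` of the `m` indices with the largest calibration scores `c`,
breaking ties by index: `i ∈ T` iff at most `m` indices `j` satisfy
`(c j, j) ≥ (c i, i)` lexicographically (note `j = i` always counts). -/
noncomputable def topIndices {N : ℕ} (c : Fin N → ℝ) (m : ℕ) : Finset (Fin N) :=
  Finset.univ.filter fun i =>
    (Finset.univ.filter fun j => c i < c j ∨ (c i = c j ∧ i ≤ j)).card ≤ m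

/-- The label-trimmed calibration set `D^LT`: all indices outside the annotated
set `T = topIndices c m`, together with the annotated indices that are true
inliers (i.e. whose index is `< n0`). -/
noncomputable def labelTrimmedSet (n0 : ℕ) {N : ℕ} (c : Fin N → ℝ) (m : ℕ) :
    Finset (Fin N) :=
  Finset.univ.filter fun i => i ∉ topIndices c m ∨ i.val < n0

/-- The Label-Trim empirical quantile `Q̂^LT`: the `⌈(1−α)(n^LT+1)⌉`-th smallest
element of the trimmed calibration scores together with `+∞`. -/
noncomputable def labelTrimQuantile (n0 : ℕ) {N : ℕ} (c : Fin N → ℝ) (m : ℕ)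
    (α : ℝ) : EReal :=
  kthSmallestE
    ((⊤ : EReal) ::ₘ ((labelTrimmedSet n0 c m).val.map fun i => ((c i : ℝ) : EReal)))
    ⌈(1 - α) * (((labelTrimmedSet n0 c m).card : ℝ) + 1)⌉₊

/-- The number of indices whose score is at least that of `i`, ties broken by index. -/
noncomputable def lexRank {N : ℕ} (c : Fin N → ℝ) (i : Fin N) : ℕ :=
  (Finset.univ.filter fun j => c i < c j ∨ (c i = c j ∧ i ≤ j)).card

theorem mem_topIndices {N : ℕ} (c : Fin N → ℝ) (m : ℕ) (i : Fin N) :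
    i ∈ topIndices c m ↔ lexRank c i ≤ m := by
  simp [topIndices, lexRank]

theorem lexRank_injective {N : ℕ} (c : Fin N → ℝ) : Function.Injective (lexRank c) := by
  have key : ∀ i j, (c i < c j ∨ (c i = c j ∧ i < j)) → lexRank c j < lexRank c i := by
    intro i j hij
    refine Finset.card_lt_card ⟨fun l hl => ?_, fun h => ?_⟩
    · simp only [Finset.mem_filter, Finset.mem_univ, true_and] at hl ⊢
      grind
    · have := h (Finset.mem_filter.2 ⟨Finset.mem_univ i, Or.inr ⟨rfl, le_rfl⟩⟩)
      simp only [Finset.mem_filter, Finset.mem_univ, true_and] at this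
      grind
  intro i j hij
  rcases lt_trichotomy (c i) (c j) with h | h | h
  · have := key i j (Or.inl h); omega
  · rcases lt_trichotomy i j with h' | h' | h'
    · have := key i j (Or.inr ⟨h, h'⟩); omega
    · exact h'
    · have := key j i (Or.inr ⟨h.symm, h'⟩); omega
  · have := key j i (Or.inl h); omega

/-- If changing the score of `j` brings `i ≠ j` into the top `m`, then `i` had rank `m + 1`, and
`j` has moved from above `i` to below `i`. -/
theorem lexRank_of_entering {N : ℕ} {c c' : Fin N → ℝ} {j i : Fin N} {m : ℕ}
    (hcc : ∀ l, l ≠ j → c' l = c l) (hij : i ≠ j) (hT : ¬ lexRank c i ≤ m)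
    (hT' : lexRank c' i ≤ m) :
    lexRank c i = m + 1 ∧ (c i < c j ∨ (c i = c j ∧ i ≤ j)) ∧
      ¬ (c i < c' j ∨ (c i = c' j ∧ i ≤ j)) := by
  have hi := hcc i hij
  have hle : lexRank c i ≤ lexRank c' i + 1 := by
    unfold lexRank
    refine (Finset.card_le_card (t := insert j
      (Finset.univ.filter fun l => c' i < c' l ∨ (c' i = c' l ∧ i ≤ l))) ?_).trans
      (Finset.card_insert_le _ _)
    intro l hl
    by_cases hlj : l = j
    · simp [hlj]
    · simpa [hlj, hi, hcc l hlj] using hl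
  have hmono : ((c i < c j ∨ (c i = c j ∧ i ≤ j)) → (c i < c' j ∨ (c i = c' j ∧ i ≤ j))) →
      lexRank c i ≤ lexRank c' i := by
    intro h
    refine Finset.card_le_card fun l hl => ?_
    simp only [Finset.mem_filter, Finset.mem_univ, true_and] at hl ⊢
    by_cases hlj : l = j
    · subst hlj; rw [hi]; exact h hl
    · rwa [hi, hcc l hlj]
  refine ⟨by omega, ?_, ?_⟩
  · by_contra h
    exact hT ((hmono fun h' => absurd h' h).trans hT')
  · intro h
    exact hT ((hmono fun _ => h).trans hT')

/-- The outliers that survive the trimming. -/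
noncomputable def survivingOutliers (n0 : ℕ) {N : ℕ} (c : Fin N → ℝ) (m : ℕ) : Finset (Fin N) :=
  (labelTrimmedSet n0 c m).filter fun i => n0 ≤ i.val

theorem mem_survivingOutliers {n0 N : ℕ} {c : Fin N → ℝ} {m : ℕ} {i : Fin N} :
    i ∈ survivingOutliers n0 c m ↔ n0 ≤ i.val ∧ ¬ lexRank c i ≤ m := by
  simp only [survivingOutliers, labelTrimmedSet, Finset.mem_filter, Finset.mem_univ, true_and,
    mem_topIndices]
  constructor
  · rintro ⟨h | h, h'⟩
    · exact ⟨h', h⟩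
    · omega
  · rintro ⟨h, h'⟩
    exact ⟨Or.inl h', h⟩

theorem card_labelTrimmedSet {n0 N : ℕ} (hN : n0 ≤ N) (c : Fin N → ℝ) (m : ℕ) :
    (labelTrimmedSet n0 c m).card = n0 + (survivingOutliers n0 c m).card := by
  rw [← Finset.card_filter_add_card_filter_not (s := labelTrimmedSet n0 c m)
    (fun i => i.val < n0)]
  congr 1
  · have : (labelTrimmedSet n0 c m).filter (fun i => i.val < n0)
        = Finset.univ.map (Fin.castLEEmb hN) := by
      ext i
      simp only [labelTrimmedSet, Finset.mem_filter, Finset.mem_univ, true_and, Finset.mem_map,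
        Fin.castLEEmb_apply]
      constructor
      · rintro ⟨-, h⟩
        exact ⟨⟨i, h⟩, rfl⟩
      · rintro ⟨a, rfl⟩
        exact ⟨Or.inr a.2, a.2⟩
    rw [this]; simp
  · simp [survivingOutliers]

/-- Changing the score of one inlier changes the set of surviving outliers by at most one
element. -/
theorem card_survivingOutliers_sdiff_add_le_one {n0 N : ℕ} {c c' : Fin N → ℝ} {j : Fin N} (m : ℕ)
    (hj : j.val < n0) (hcc : ∀ l, l ≠ j → c' l = c l) :
    (survivingOutliers n0 c m \ survivingOutliers n0 c' m).card
      + (survivingOutliers n0 c' m \ survivingOutliers n0 c m).card ≤ 1 := by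
  have hmem : ∀ {c c' : Fin N → ℝ} {i}, (∀ l, l ≠ j → c' l = c l) →
      i ∈ survivingOutliers n0 c m \ survivingOutliers n0 c' m →
      i ≠ j ∧ lexRank c i = m + 1 ∧ (c i < c j ∨ (c i = c j ∧ i ≤ j)) ∧
      ¬ (c i < c' j ∨ (c i = c' j ∧ i ≤ j)) := by
    intro c c' i hcc hi
    simp only [Finset.mem_sdiff, mem_survivingOutliers] at hi
    have hij : i ≠ j := by rintro rfl; omega
    exact ⟨hij, lexRank_of_entering hcc hij hi.1.2 (by tauto)⟩
  have hcc' : ∀ l, l ≠ j → c l = c' l := fun l hl => (hcc l hl).symm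
  have hone : ∀ {c c' : Fin N → ℝ}, (∀ l, l ≠ j → c' l = c l) →
      (survivingOutliers n0 c m \ survivingOutliers n0 c' m).card ≤ 1 := by
    intro c c' hcc
    refine Finset.card_le_one.2 fun a ha b hb => lexRank_injective c ?_
    rw [(hmem hcc ha).2.1, (hmem hcc hb).2.1]
  rcases Finset.eq_empty_or_nonempty (survivingOutliers n0 c m \ survivingOutliers n0 c' m)
    with h | ⟨a, ha⟩
  · rw [h, Finset.card_empty, zero_add]
    exact hone hcc'
  · rcases Finset.eq_empty_or_nonempty (survivingOutliers n0 c' m \ survivingOutliers n0 c m)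
      with h | ⟨b, hb⟩
    · rw [h, Finset.card_empty, add_zero]
      exact hone hcc
    · obtain ⟨haj, -, ha1, ha2⟩ := hmem hcc ha
      obtain ⟨hbj, -, hb1, hb2⟩ := hmem hcc' hb
      have := hcc a haj
      have := hcc b hbj
      grind

/-- A number is at most the `k`-th smallest element iff fewer than `k` elements lie below it. -/
theorem le_kthSmallestE_iff {A : Multiset EReal} {k : ℕ} (hk : 1 ≤ k) (hkA : k ≤ A.card)
    (x : EReal) : x ≤ kthSmallestE A k ↔ (A.filter (· < x)).card < k := by
  have hlen : (A.sort (· ≤ ·)).length = A.card := Multiset.length_sort _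
  have hs : (A.sort (· ≤ ·)).Pairwise (· ≤ ·) := Multiset.pairwise_sort _ _
  have hcard : (A.filter (· < x)).card = (A.sort (· ≤ ·)).countP (· < x) := by
    conv_lhs => rw [← Multiset.sort_eq A (· ≤ ·)]
    rw [Multiset.filter_coe, Multiset.coe_card, List.countP_eq_length_filter]
  rw [hcard, kthSmallestE]
  generalize A.sort (· ≤ ·) = L at *
  have hkL : k - 1 < L.length := by omega
  rw [List.getD_eq_getElem _ _ hkL]
  have hmono : ∀ a b (ha : a < L.length) (hb : b < L.length), a ≤ b → L[a] ≤ L[b] := by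
    intro a b ha hb hab
    rcases hab.eq_or_lt with rfl | hab
    · rfl
    · exact List.pairwise_iff_getElem.1 hs a b ha hb hab
  constructor
  · intro hx
    have hdrop : (L.drop (k - 1)).countP (· < x) = 0 := by
      rw [List.countP_eq_zero]
      intro y hy
      obtain ⟨i, hi, rfl⟩ := List.mem_iff_getElem.1 hy
      rw [List.getElem_drop]
      simpa using hx.trans (hmono _ _ hkL _ (by omega))
    rw [← List.take_append_drop (k - 1) L, List.countP_append, hdrop]
    have := List.countP_le_length (p := (· < x)) (l := L.take (k - 1))
    rw [List.length_take] at this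
    omega
  · intro hlt
    by_contra hx
    rw [not_le] at hx
    have htake : (L.take k).countP (· < x) = (L.take k).length := by
      rw [List.countP_eq_length]
      intro y hy
      obtain ⟨i, hi, rfl⟩ := List.mem_iff_getElem.1 hy
      rw [List.length_take] at hi
      rw [List.getElem_take]
      simpa using (hmono i (k - 1) (by omega) hkL (by omega)).trans_lt hx
    have hsub := (List.take_sublist k L).countP_le (p := (· < x))
    rw [htake, List.length_take] at hsub
    omega

theorem coe_le_labelTrimQuantile_iff {n0 N : ℕ} (c : Fin N → ℝ) (m : ℕ) {α : ℝ}
    (hα : α ∈ Set.Ioo (0 : ℝ) 1) (x : ℝ) :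
    (x : EReal) ≤ labelTrimQuantile n0 c m α ↔
      (((labelTrimmedSet n0 c m).filter fun i => c i < x).card : ℝ)
        < (1 - α) * (((labelTrimmedSet n0 c m).card : ℝ) + 1) := by
  have hpos : 0 < (1 - α) * (((labelTrimmedSet n0 c m).card : ℝ) + 1) :=
    mul_pos (by linarith [hα.2]) (by positivity)
  rw [labelTrimQuantile, le_kthSmallestE_iff (Nat.one_le_ceil_iff.2 hpos), ← Nat.lt_ceil]
  · rw [Multiset.filter_cons_of_neg _ (by simp), Multiset.filter_map, Multiset.card_map]
    simp only [Function.comp_def, EReal.coe_lt_coe_iff]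
    rfl
  · rw [Multiset.card_cons, Multiset.card_map, Nat.ceil_le, ← Finset.card_def]
    push_cast
    nlinarith [hα.1]

/-- At most a fraction `α` of the trimmed scores, up to the added point, exceeds the quantile. -/
theorem card_quantile_lt_le {n0 N : ℕ} (c : Fin N → ℝ) (m : ℕ) {α : ℝ}
    (hα : α ∈ Set.Ioo (0 : ℝ) 1) :
    (((labelTrimmedSet n0 c m).filter
        fun i => ¬ ((c i : ℝ) : EReal) ≤ labelTrimQuantile n0 c m α).card : ℝ)
      ≤ α * (((labelTrimmedSet n0 c m).card : ℝ) + 1) := by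
  set D := labelTrimmedSet n0 c m with hD
  set V := D.filter fun i => ¬ ((c i : ℝ) : EReal) ≤ labelTrimQuantile n0 c m α with hV
  rcases V.eq_empty_or_nonempty with h | h
  · rw [h, Finset.card_empty, Nat.cast_zero]
    exact mul_nonneg hα.1.le (by positivity)
  · obtain ⟨i, hi, hmin⟩ := V.exists_min_image c h
    have hi' := (Finset.mem_filter.1 hi).2
    rw [coe_le_labelTrimQuantile_iff c m hα, not_lt, ← hD] at hi'
    have hsub : V ⊆ D.filter fun l => ¬ c l < c i := fun l hl =>
      Finset.mem_filter.2 ⟨(Finset.mem_filter.1 hl).1, not_lt.2 (hmin l hl)⟩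
    have h1 : (V.card : ℝ) ≤ ((D.filter fun l => ¬ c l < c i).card : ℝ) := by
      exact_mod_cast Finset.card_le_card hsub
    have h2 : ((D.filter fun l => c l < c i).card : ℝ)
        + ((D.filter fun l => ¬ c l < c i).card : ℝ) = D.card := by
      exact_mod_cast Finset.card_filter_add_card_filter_not (s := D) (fun l => c l < c i)
    linarith

/-- The event `p̂ ≤ α` for the scores `s`, the last of which is the test score. -/
def IsRejected (n0 m : ℕ) (α : ℝ) {N : ℕ} (s : Fin (N + 1) → ℝ) : Prop :=
  (1 + (((labelTrimmedSet n0 (fun i : Fin N => s i.castSucc) m).filter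
      fun i => s (Fin.last N) ≤ s i.castSucc).card : ℝ))
    / (((labelTrimmedSet n0 (fun i : Fin N => s i.castSucc) m).card : ℝ) + 1) ≤ α

theorem mem_labelTrimmedSet_of_lt {n0 N : ℕ} (c : Fin N → ℝ) (m : ℕ) {i : Fin N}
    (hi : i.val < n0) : i ∈ labelTrimmedSet n0 c m := by
  simp [labelTrimmedSet, hi]

theorem card_filter_labelTrimmedSet {n0 N : ℕ} (c : Fin N → ℝ) (m : ℕ) (q : Fin N → Prop)
    [DecidablePred q] :
    ((labelTrimmedSet n0 c m).filter q).card
      = ((labelTrimmedSet n0 c m).filter fun i => i.val < n0 ∧ q i).card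
        + ((survivingOutliers n0 c m).filter q).card := by
  rw [← Finset.card_filter_add_card_filter_not (s := (labelTrimmedSet n0 c m).filter q)
    (fun i => i.val < n0), survivingOutliers, Finset.filter_filter, Finset.filter_filter,
    Finset.filter_filter]
  simp only [not_lt, and_comm]

theorem swap_last_castSucc_of_le {n0 N : ℕ} {j : Fin (N + 1)} (hj : j.val < n0 ∨ j.val = N)
    {i : Fin N} (hi : n0 ≤ i.val) : Equiv.swap j (Fin.last N) i.castSucc = i.castSucc := by
  refine Equiv.swap_apply_of_ne_of_ne ?_ (Fin.castSucc_lt_last i).ne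
  rintro rfl
  have := i.2
  rw [Fin.val_castSucc] at hj
  omega

/-- Exchanging the test score with an inlier score changes the set of surviving outliers by at
most one element. -/
theorem card_survivingOutliers_swap {n0 N : ℕ} (m : ℕ) (s : Fin (N + 1) → ℝ) {j : Fin (N + 1)}
    (hj : j.val < n0 ∨ j.val = N) :
    (survivingOutliers n0 (fun i : Fin N => s i.castSucc) m \ survivingOutliers n0
        (fun i : Fin N => s (Equiv.swap j (Fin.last N) i.castSucc)) m).card
      + (survivingOutliers n0 (fun i : Fin N => s (Equiv.swap j (Fin.last N) i.castSucc)) m \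
        survivingOutliers n0 (fun i : Fin N => s i.castSucc) m).card ≤ 1 := by
  induction j using Fin.lastCases with
  | last => simp
  | cast j =>
    have hj' : j.val < n0 := by
      have := j.2
      rw [Fin.val_castSucc] at hj
      omega
    refine card_survivingOutliers_sdiff_add_le_one m hj' fun l hl => ?_
    rw [Equiv.swap_apply_of_ne_of_ne (by simpa using hl) (Fin.castSucc_lt_last l).ne]

open scoped Classical in
/-- Every set of inlier scores (the test score included) lying above the score `j`, together with
the surviving outliers above it, respects the rejection threshold obtained when `j` plays the
role of the test score. -/
theorem card_add_card_le_of_isRejected_swap {n0 N m : ℕ} (hN : n0 ≤ N) {α : ℝ}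
    {s : Fin (N + 1) → ℝ} {j : Fin (N + 1)} (hj : j.val < n0 ∨ j.val = N)
    (hrej : IsRejected n0 m α fun i => s (Equiv.swap j (Fin.last N) i))
    {J : Finset (Fin (N + 1))} (hJ : ∀ l ∈ J, l.val < n0 ∨ l.val = N)
    (hmin : ∀ l ∈ J, s j ≤ s l) :
    (J.card : ℝ) + (((survivingOutliers n0
        (fun i : Fin N => s (Equiv.swap j (Fin.last N) i.castSucc)) m).filter
          fun i => s j ≤ s i.castSucc).card : ℝ)
      ≤ α * (n0 + ((survivingOutliers n0
        (fun i : Fin N => s (Equiv.swap j (Fin.last N) i.castSucc)) m).card : ℝ) + 1) := by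
  rw [IsRejected, div_le_iff₀ (by positivity), card_filter_labelTrimmedSet,
    card_labelTrimmedSet hN, Equiv.swap_apply_right] at hrej
  set c' : Fin N → ℝ := fun i => s (Equiv.swap j (Fin.last N) i.castSucc) with hc'
  have hout : ((survivingOutliers n0 c' m).filter fun i => s j ≤ s i.castSucc)
      = (survivingOutliers n0 c' m).filter fun i => s j ≤ c' i := by
    refine Finset.filter_congr fun i hi => ?_
    simp only [hc', swap_last_castSucc_of_le hj (mem_survivingOutliers.1 hi).1]
  have hin : J.card ≤ ((labelTrimmedSet n0 c' m).filter
      fun i => i.val < n0 ∧ s j ≤ c' i).card + 1 := by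
    refine (Finset.card_le_card (t := insert j (((labelTrimmedSet n0 c' m).filter
      fun i => i.val < n0 ∧ s j ≤ c' i).image
        fun i => Equiv.swap j (Fin.last N) i.castSucc)) fun l hl => ?_).trans
      ((Finset.card_insert_le _ _).trans (by gcongr; exact Finset.card_image_le))
    rw [Finset.mem_insert, or_iff_not_imp_left]
    intro hlj
    have hne : Equiv.swap j (Fin.last N) l ≠ Fin.last N := by
      intro h
      exact hlj ((Equiv.swap j (Fin.last N)).injective
        (h.trans (Equiv.swap_apply_left j (Fin.last N)).symm))
    obtain ⟨i, hi⟩ := Fin.exists_castSucc_eq.2 hne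
    have hil : Equiv.swap j (Fin.last N) i.castSucc = l := by rw [hi, Equiv.swap_apply_self]
    have hi0 : i.val < n0 := by
      by_contra h
      rw [swap_last_castSucc_of_le hj (not_lt.1 h)] at hil
      have h1 := hJ l hl
      have h2 := i.2
      rw [← hil, Fin.val_castSucc] at h1
      omega
    refine Finset.mem_image.2 ⟨i, Finset.mem_filter.2
      ⟨mem_labelTrimmedSet_of_lt c' m hi0, hi0, ?_⟩, hil⟩
    rw [hc']
    simpa only [hil] using hmin l hl
  rw [hout]
  have hin' : (J.card : ℝ) ≤ (((labelTrimmedSet n0 c' m).filter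
      fun i => i.val < n0 ∧ s j ≤ c' i).card : ℝ) + 1 := by exact_mod_cast hin
  push_cast at hrej
  linarith

open scoped Classical in
/-- The number of inlier scores (the test score included) that would be rejected when playing the
role of the test score. -/
theorem card_isRejected_swap_le {n0 N m : ℕ} (hN : n0 ≤ N) {α : ℝ} (hα : α ∈ Set.Ioo (0 : ℝ) 1)
    (s : Fin (N + 1) → ℝ) :
    ((Finset.univ.filter fun j : Fin (N + 1) => (j.val < n0 ∨ j.val = N) ∧
        IsRejected n0 m α fun i => s (Equiv.swap j (Fin.last N) i)).card : ℝ)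
      ≤ α * (n0 + 1) + 1
        - ((((labelTrimmedSet n0 (fun i : Fin N => s i.castSucc) m).filter
              fun i => n0 ≤ i.val).card : ℝ) * (1 - α)
          - (((labelTrimmedSet n0 (fun i : Fin N => s i.castSucc) m).filter
              fun i => n0 ≤ i.val ∧ ((s i.castSucc : ℝ) : EReal) ≤
                labelTrimQuantile n0 (fun j : Fin N => s j.castSucc) m α).card : ℝ)) := by
  set J := Finset.univ.filter fun j : Fin (N + 1) => (j.val < n0 ∨ j.val = N) ∧
    IsRejected n0 m α fun i => s (Equiv.swap j (Fin.last N) i) with hJdef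
  set c : Fin N → ℝ := fun i => s i.castSucc with hc
  set Q := labelTrimQuantile n0 c m α with hQ
  have hJ : ∀ l ∈ J, l.val < n0 ∨ l.val = N := fun l hl => (Finset.mem_filter.1 hl).2.1
  have hexc := card_quantile_lt_le (n0 := n0) c m hα
  rw [← hQ, card_filter_labelTrimmedSet, card_labelTrimmedSet hN] at hexc
  push_cast at hexc
  rw [← Finset.filter_filter]
  change (J.card : ℝ) ≤ α * (n0 + 1) + 1 - (((survivingOutliers n0 c m).card : ℝ) * (1 - α)
    - (((survivingOutliers n0 c m).filter fun i => ((c i : ℝ) : EReal) ≤ Q).card : ℝ))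
  have hsplit : (((survivingOutliers n0 c m).filter fun i => ((c i : ℝ) : EReal) ≤ Q).card : ℝ)
      + (((survivingOutliers n0 c m).filter fun i => ¬ ((c i : ℝ) : EReal) ≤ Q).card : ℝ)
      = ((survivingOutliers n0 c m).card : ℝ) := by
    exact_mod_cast Finset.card_filter_add_card_filter_not _
  suffices h : (J.card : ℝ)
      + (((survivingOutliers n0 c m).filter fun i => ¬ ((c i : ℝ) : EReal) ≤ Q).card : ℝ)
      ≤ α * (n0 + (survivingOutliers n0 c m).card + 1) + 1 by linarith
  by_cases hex : ∃ j ∈ J, ((s j : ℝ) : EReal) ≤ Q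
  · obtain ⟨j', hj', hjQ'⟩ := hex
    obtain ⟨j, hjJ, hmin⟩ := J.exists_min_image s ⟨j', hj'⟩
    have hjQ : ((s j : ℝ) : EReal) ≤ Q := (EReal.coe_le_coe_iff.2 (hmin j' hj')).trans hjQ'
    have hbound := card_add_card_le_of_isRejected_swap hN (hJ j hjJ)
      (Finset.mem_filter.1 hjJ).2.2 hJ hmin
    have hdiff := card_survivingOutliers_swap m s (hJ j hjJ)
    rw [← hc] at hdiff
    set A := survivingOutliers n0 c m
    set B := survivingOutliers n0 (fun i : Fin N => s (Equiv.swap j (Fin.last N) i.castSucc)) m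
    have hV : (A.filter fun i => ¬ ((c i : ℝ) : EReal) ≤ Q).card
        ≤ (B.filter fun i => s j ≤ s i.castSucc).card + (A \ B).card := by
      refine (Finset.card_le_card fun i hi => ?_).trans (Finset.card_union_le _ _)
      obtain ⟨hiA, hi⟩ := Finset.mem_filter.1 hi
      rw [Finset.mem_union]
      by_cases hiB : i ∈ B
      · exact Or.inl (Finset.mem_filter.2
          ⟨hiB, (EReal.coe_lt_coe_iff.1 (hjQ.trans_lt (not_le.1 hi))).le⟩)
      · exact Or.inr (Finset.mem_sdiff.2 ⟨hiA, hiB⟩)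
    have hAB := Finset.card_sdiff_add_card_inter A B
    have hBA := Finset.card_sdiff_add_card_inter B A
    rw [Finset.inter_comm] at hBA
    rify at hdiff hV hAB hBA
    have hA0 : (0 : ℝ) ≤ (A \ B).card := Nat.cast_nonneg _
    have hB0 : (0 : ℝ) ≤ (B \ A).card := Nat.cast_nonneg _
    nlinarith [hα.1, hα.2]
  · push Not at hex
    have hin : J.card ≤ ((labelTrimmedSet n0 c m).filter
        fun i => i.val < n0 ∧ ¬ ((c i : ℝ) : EReal) ≤ Q).card + 1 := by
      refine (Finset.card_le_card (t := insert (Fin.last N) (((labelTrimmedSet n0 c m).filter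
        fun i => i.val < n0 ∧ ¬ ((c i : ℝ) : EReal) ≤ Q).image Fin.castSucc))
          fun l hl => ?_).trans
        ((Finset.card_insert_le _ _).trans (by gcongr; exact Finset.card_image_le))
      rw [Finset.mem_insert, or_iff_not_imp_left]
      intro hne
      obtain ⟨i, rfl⟩ := Fin.exists_castSucc_eq.2 hne
      have hi0 : i.val < n0 := by
        have h1 := hJ _ hl
        have h2 := i.2
        rw [Fin.val_castSucc] at h1
        omega
      exact Finset.mem_image_of_mem _ (Finset.mem_filter.2
        ⟨mem_labelTrimmedSet_of_lt c m hi0, hi0, not_le.2 (hex _ hl)⟩)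
    have hin' : (J.card : ℝ) ≤ (((labelTrimmedSet n0 c m).filter
        fun i => i.val < n0 ∧ ¬ ((c i : ℝ) : EReal) ≤ Q).card : ℝ) + 1 := by exact_mod_cast hin
    linarith

theorem measurable_card_filter {X ι : Type*} [MeasurableSpace X] [Fintype ι]
    {D : X → Finset ι} {p : X → ι → Prop} [∀ x, DecidablePred (p x)]
    (hD : ∀ i, MeasurableSet {x | i ∈ D x}) (hp : ∀ i, MeasurableSet {x | p x i}) :
    Measurable fun x => ((D x).filter (p x)).card := by
  classical
  have : (fun x => ((D x).filter (p x)).card)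
      = fun x => ∑ i, Set.indicator ({x | i ∈ D x} ∩ {x | p x i}) (fun _ => 1) x := by
    funext x
    rw [Finset.card_eq_sum_ones, Finset.sum_filter, ← Finset.sum_subset (Finset.subset_univ (D x))]
    · refine Finset.sum_congr rfl fun i hi => ?_
      simp [Set.indicator_apply, hi]
    · intro i _ hi
      simp [hi]
  rw [this]
  exact Finset.measurable_sum _ fun i _ => measurable_const.indicator ((hD i).inter (hp i))

theorem measurableSet_mem_labelTrimmedSet (n0 : ℕ) {N : ℕ} (m : ℕ) (i : Fin N) :
    MeasurableSet {c : Fin N → ℝ | i ∈ labelTrimmedSet n0 c m} := by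
  have hrank : Measurable fun c : Fin N → ℝ => lexRank c i := by
    refine measurable_card_filter (fun _ => by simp) fun j => ?_
    exact (measurableSet_lt (measurable_pi_apply i) (measurable_pi_apply j)).union
      ((measurableSet_eq_fun (measurable_pi_apply i) (measurable_pi_apply j)).inter
        (MeasurableSet.const _))
  have : {c : Fin N → ℝ | i ∈ labelTrimmedSet n0 c m}
      = {c | lexRank c i ≤ m}ᶜ ∪ {_c | i.val < n0} := by
    ext c
    simp [labelTrimmedSet, mem_topIndices]
  rw [this]
  exact (measurableSet_le hrank measurable_const).compl.union (MeasurableSet.const _)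

theorem measurable_card_labelTrimmedSet_filter (n0 : ℕ) {N : ℕ} (m : ℕ)
    {p : (Fin (N + 1) → ℝ) → Fin N → Prop} [∀ s, DecidablePred (p s)]
    (hp : ∀ i, MeasurableSet {s | p s i}) :
    Measurable fun s : Fin (N + 1) → ℝ =>
      ((labelTrimmedSet n0 (fun i : Fin N => s i.castSucc) m).filter (p s)).card :=
  measurable_card_filter (fun i =>
    (measurable_pi_lambda (fun s : Fin (N + 1) → ℝ => fun i : Fin N => s i.castSucc)
      fun i => measurable_pi_apply i.castSucc) (measurableSet_mem_labelTrimmedSet n0 m i)) hp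

theorem measurable_card_labelTrimmedSet (n0 : ℕ) {N : ℕ} (m : ℕ) :
    Measurable fun s : Fin (N + 1) → ℝ =>
      (labelTrimmedSet n0 (fun i : Fin N => s i.castSucc) m).card := by
  simpa using measurable_card_labelTrimmedSet_filter n0 (N := N) m (p := fun _ _ => True)
    fun _ => MeasurableSet.const _

theorem measurableSet_isRejected (n0 m : ℕ) (α : ℝ) (N : ℕ) :
    MeasurableSet {s : Fin (N + 1) → ℝ | IsRejected n0 m α s} := by
  refine measurableSet_le (Measurable.div (measurable_const.add
    (measurable_from_top.comp (measurable_card_labelTrimmedSet_filter n0 m fun i => ?_)))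
    ((measurable_from_top.comp (measurable_card_labelTrimmedSet n0 m)).add measurable_const))
    measurable_const
  exact measurableSet_le (measurable_pi_apply _) (measurable_pi_apply _)

theorem measurableSet_le_labelTrimQuantile (n0 m : ℕ) {α : ℝ} (hα : α ∈ Set.Ioo (0 : ℝ) 1)
    {N : ℕ} (i : Fin N) :
    MeasurableSet {s : Fin (N + 1) → ℝ | ((s i.castSucc : ℝ) : EReal) ≤
      labelTrimQuantile n0 (fun j : Fin N => s j.castSucc) m α} := by
  simp only [coe_le_labelTrimQuantile_iff _ m hα]
  refine measurableSet_lt (measurable_from_top.comp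
    (measurable_card_labelTrimmedSet_filter n0 m fun j => ?_))
    (measurable_const.mul ((measurable_from_top.comp
      (measurable_card_labelTrimmedSet n0 m)).add measurable_const))
  exact measurableSet_lt (measurable_pi_apply _) (measurable_pi_apply _)

theorem integrable_card_labelTrimmedSet_filter (n0 : ℕ) {N : ℕ} (m : ℕ)
    (ν : Measure (Fin (N + 1) → ℝ)) [IsFiniteMeasure ν]
    {p : (Fin (N + 1) → ℝ) → Fin N → Prop} [∀ s, DecidablePred (p s)]
    (hp : ∀ i, MeasurableSet {s | p s i}) :
    Integrable (fun s : Fin (N + 1) → ℝ =>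
      (((labelTrimmedSet n0 (fun i : Fin N => s i.castSucc) m).filter (p s)).card : ℝ)) ν := by
  refine Integrable.of_bound (C := N) (measurable_from_top.comp
    (measurable_card_labelTrimmedSet_filter n0 m hp)).aestronglyMeasurable
    (Filter.Eventually.of_forall fun s => ?_)
  rw [Real.norm_natCast]
  exact_mod_cast (Finset.card_le_univ _).trans (Fintype.card_fin N).le

theorem integrable_trimming_gain (n0 m : ℕ) {α : ℝ} (hα : α ∈ Set.Ioo (0 : ℝ) 1) {N : ℕ}
    (ν : Measure (Fin (N + 1) → ℝ)) [IsFiniteMeasure ν] :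
    Integrable (fun s : Fin (N + 1) → ℝ =>
      (((labelTrimmedSet n0 (fun i : Fin N => s i.castSucc) m).filter
          fun i => n0 ≤ i.val).card : ℝ) * (1 - α)
        - (((labelTrimmedSet n0 (fun i : Fin N => s i.castSucc) m).filter
            fun i => n0 ≤ i.val ∧ ((s i.castSucc : ℝ) : EReal) ≤
              labelTrimQuantile n0 (fun j : Fin N => s j.castSucc) m α).card : ℝ)) ν := by
  have hout := integrable_card_labelTrimmedSet_filter n0 m ν
    (p := fun _ (i : Fin N) => n0 ≤ i.val) fun _ => MeasurableSet.const _
  have hbelow := integrable_card_labelTrimmedSet_filter n0 m ν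
    (p := fun s (i : Fin N) => n0 ≤ i.val ∧ ((s i.castSucc : ℝ) : EReal) ≤
      labelTrimQuantile n0 (fun j : Fin N => s j.castSucc) m α)
    fun i => (MeasurableSet.const _).inter (measurableSet_le_labelTrimQuantile n0 m hα i)
  exact (hout.mul_const (1 - α)).sub hbelow

/-- A product measure is invariant under permutations of coordinates with equal marginals. -/
theorem measurePreserving_pi_comp_perm {ι X : Type*} [Fintype ι] [MeasurableSpace X]
    (μ : ι → Measure X) [∀ i, SigmaFinite (μ i)] (τ : Equiv.Perm ι) (hτ : ∀ i, μ (τ i) = μ i) :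
    MeasurePreserving (fun (s : ι → X) i => s (τ i)) (Measure.pi μ) (Measure.pi μ) := by
  have hmeas : Measurable fun (s : ι → X) i => s (τ i) :=
    measurable_pi_lambda _ fun i => measurable_pi_apply _
  refine ⟨hmeas, (Measure.pi_eq fun t ht => ?_).symm⟩
  rw [Measure.map_apply hmeas (MeasurableSet.univ_pi ht)]
  have : (fun (s : ι → X) i => s (τ i)) ⁻¹' Set.univ.pi t
      = Set.univ.pi fun i => t (τ.symm i) := by
    ext s
    simp only [Set.mem_preimage, Set.mem_univ_pi]
    exact ⟨fun h i => by simpa using h (τ.symm i), fun h i => by simpa using h (τ i)⟩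
  rw [this, Measure.pi_pi, ← Equiv.prod_comp τ]
  simp [hτ]

theorem card_filter_inlier_or_test {n0 N : ℕ} (hN : n0 ≤ N) :
    (Finset.univ.filter fun j : Fin (N + 1) => j.val < n0 ∨ j.val = N).card = n0 + 1 := by
  have : (Finset.univ.filter fun j : Fin (N + 1) => j.val < n0 ∨ j.val = N)
      = insert (Fin.last N) (Finset.univ.map (Fin.castLEEmb (hN.trans N.le_succ))) := by
    ext j
    simp only [Finset.mem_filter, Finset.mem_univ, true_and, Finset.mem_insert, Finset.mem_map,
      Fin.castLEEmb_apply]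
    constructor
    · rintro (h | h)
      · exact Or.inr ⟨⟨j, h⟩, rfl⟩
      · exact Or.inl (Fin.ext h)
    · rintro (rfl | ⟨a, rfl⟩)
      · exact Or.inr rfl
      · exact Or.inl a.2
  rw [this, Finset.card_insert_of_notMem]
  · simp
  · simp only [Finset.mem_map, Finset.mem_univ, true_and, not_exists]
    intro a ha
    have := congrArg Fin.val ha
    simp at this
    omega

/-- The rejection probability under any law of the scores that is invariant under exchanging the
test score with an inlier score. -/
theorem measureReal_isRejected_le {n0 N m : ℕ} (hN : n0 ≤ N) {α : ℝ}
    (hα : α ∈ Set.Ioo (0 : ℝ) 1) (ν : Measure (Fin (N + 1) → ℝ)) [IsProbabilityMeasure ν]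
    (hν : ∀ j : Fin (N + 1), (j.val < n0 ∨ j.val = N) →
      MeasurePreserving (fun s i => s (Equiv.swap j (Fin.last N) i)) ν ν) :
    ν.real {s | IsRejected n0 m α s} ≤ α + 1 / (n0 + 1) - (1 / (n0 + 1)) *
      ∫ s, ((((labelTrimmedSet n0 (fun i : Fin N => s i.castSucc) m).filter
              fun i => n0 ≤ i.val).card : ℝ) * (1 - α)
          - (((labelTrimmedSet n0 (fun i : Fin N => s i.castSucc) m).filter
              fun i => n0 ≤ i.val ∧ ((s i.castSucc : ℝ) : EReal) ≤
                labelTrimQuantile n0 (fun j : Fin N => s j.castSucc) m α).card : ℝ)) ∂ν := by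
  classical
  set E := {s : Fin (N + 1) → ℝ | IsRejected n0 m α s} with hE
  have hEm : MeasurableSet E := measurableSet_isRejected n0 m α N
  set I := Finset.univ.filter fun j : Fin (N + 1) => j.val < n0 ∨ j.val = N with hI
  let F : Fin (N + 1) → Set (Fin (N + 1) → ℝ) := fun j =>
    (fun s i => s (Equiv.swap j (Fin.last N) i)) ⁻¹' E
  have hFm : ∀ j, MeasurableSet (F j) := fun j =>
    measurable_pi_lambda (fun (s : Fin (N + 1) → ℝ) i => s (Equiv.swap j (Fin.last N) i))
      (fun i => measurable_pi_apply _) hEm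
  have hF : ∀ j ∈ I, ∫ s, (F j).indicator (fun _ => (1 : ℝ)) s ∂ν = ν.real E := by
    intro j hj
    rw [integral_indicator_const _ (hFm j), smul_eq_mul, mul_one]
    exact (hν j (Finset.mem_filter.1 hj).2).measureReal_preimage hEm.nullMeasurableSet
  have hFint : ∀ j, Integrable ((F j).indicator fun _ => (1 : ℝ)) ν := fun j =>
    (integrable_const 1).indicator (hFm j)
  have hsum : ((n0 : ℝ) + 1) * ν.real E
      = ∫ s, ∑ j ∈ I, (F j).indicator (fun _ => (1 : ℝ)) s ∂ν := by
    rw [integral_finsetSum _ fun j _ => hFint j, Finset.sum_congr rfl hF, Finset.sum_const,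
      hI, card_filter_inlier_or_test hN, nsmul_eq_mul]
    push_cast
    rfl
  have hG := integrable_trimming_gain n0 m hα ν
  have hle := integral_mono (integrable_finsetSum I fun j _ => hFint j)
    ((integrable_const (μ := ν) (α * ((n0 : ℝ) + 1) + 1)).sub hG) fun s => by
      refine le_trans (le_of_eq ?_) (card_isRejected_swap_le (m := m) hN hα s)
      rw [← Finset.filter_filter, Finset.card_filter]
      push_cast
      exact Finset.sum_congr rfl fun j _ => by simp [F, E, Set.indicator_apply]
  rw [← hsum, integral_sub' (integrable_const _) hG] at hle
  simp only [integral_const, probReal_univ, one_smul] at hle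
  have hn : (0 : ℝ) < n0 + 1 := by positivity
  rw [← mul_le_mul_iff_right₀ hn]
  refine hle.trans (le_of_eq ?_)
  rw [mul_sub _ _ (1 / _ * _), mul_add _ α (1 / _), mul_one_div_cancel hn.ne', ← mul_assoc, mul_one_div_cancel hn.ne', one_mul,
    mul_comm α]

/-- Theorem 4.1: approximate type-I error validity of the
Label-Trim conformal p-value.  The calibration set contains `n0` inliers
(indices `< n0`, law `μ0`) and `n1` outliers (indices `≥ n0`, law `μ1`),
the test score `S (Fin.last _)` has the inlier law `μ0`, and all `n+1` scores
are mutually independent, with both laws atomless.  Given a labeling budget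
`1 ≤ m ≤ n` with `m ≤ α(n+1)`, the Label-Trim procedure annotates the `m`
largest calibration scores and removes the annotated outliers; its conformal
p-value `p̂^LT` satisfies
`P(p̂^LT ≤ α) ≤ α + 1/(n0+1) − (1/(n0+1))·E[n̂₁^LT·(1−α) − N^LT]`, where
`n̂₁^LT` is the number of outliers remaining after trimming and `N^LT` is the
number of remaining outliers with score `≤ Q̂^LT`. -/
theorem label_trim_typeI_bound
    {Ω : Type*} [MeasurableSpace Ω] (P : Measure Ω) [IsProbabilityMeasure P]
    (n0 n1 m : ℕ) (hn1 : 1 ≤ n1) (hm1 : 1 ≤ m) (hmn : m ≤ n0 + n1)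
    (μ0 μ1 : Measure ℝ) [IsProbabilityMeasure μ0] [IsProbabilityMeasure μ1]
    (h0 : ∀ x : ℝ, μ0 {x} = 0) (h1 : ∀ x : ℝ, μ1 {x} = 0)
    (S : Fin (n0 + n1 + 1) → Ω → ℝ)
    (hmeas : ∀ i, Measurable (S i))
    (hlaw : Measure.map (fun ω i => S i ω) P
      = Measure.pi fun i : Fin (n0 + n1 + 1) =>
          if i.val < n0 ∨ i.val = n0 + n1 then μ0 else μ1)
    (α : ℝ) (hα : α ∈ Set.Ioo (0 : ℝ) 1)
    (hbudget : (m : ℝ) ≤ α * (n0 + n1 + 1)) :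
    (P {ω | (1 + (((labelTrimmedSet n0 (fun i : Fin (n0 + n1) => S i.castSucc ω) m).filter
          fun i => S (Fin.last (n0 + n1)) ω ≤ S i.castSucc ω).card : ℝ))
        / (((labelTrimmedSet n0 (fun i : Fin (n0 + n1) => S i.castSucc ω) m).card : ℝ) + 1)
        ≤ α}).toReal
      ≤ α + 1 / (n0 + 1)
        - (1 / (n0 + 1)) *
          ∫ ω,
            ((((labelTrimmedSet n0 (fun i : Fin (n0 + n1) => S i.castSucc ω) m).filter
                fun i => n0 ≤ i.val).card : ℝ) * (1 - α)
              - (((labelTrimmedSet n0 (fun i : Fin (n0 + n1) => S i.castSucc ω) m).filter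
                  fun i => n0 ≤ i.val ∧ ((S i.castSucc ω : ℝ) : EReal) ≤
                    labelTrimQuantile n0 (fun j : Fin (n0 + n1) => S j.castSucc ω) m α).card
                  : ℝ)) ∂P := by
  set μ : Fin (n0 + n1 + 1) → Measure ℝ :=
    fun i => if i.val < n0 ∨ i.val = n0 + n1 then μ0 else μ1 with hμ
  have hprob : ∀ i, IsProbabilityMeasure (μ i) := fun i => by
    rw [hμ]
    dsimp only
    split_ifs <;> infer_instance
  have hS : Measurable fun ω i => S i ω := measurable_pi_lambda _ hmeas
  have hinv : ∀ j : Fin (n0 + n1 + 1), (j.val < n0 ∨ j.val = n0 + n1) →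
      MeasurePreserving (fun s i => s (Equiv.swap j (Fin.last (n0 + n1)) i))
        (Measure.pi μ) (Measure.pi μ) := by
    refine fun j hj => measurePreserving_pi_comp_perm μ _ fun i => ?_
    have hlast : μ (Fin.last (n0 + n1)) = μ0 := by simp [hμ]
    have hjμ : μ j = μ0 := by simp [hμ, hj]
    rcases eq_or_ne i j with rfl | hij
    · rw [Equiv.swap_apply_left, hlast, hjμ]
    · rcases eq_or_ne i (Fin.last (n0 + n1)) with rfl | hil
      · rw [Equiv.swap_apply_right, hlast, hjμ]
      · rw [Equiv.swap_apply_of_ne_of_ne hij hil]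
  have hmain := measureReal_isRejected_le (m := m) (Nat.le_add_right n0 n1) hα (Measure.pi μ) hinv
  rw [← hlaw, map_measureReal_apply hS (measurableSet_isRejected n0 m α (n0 + n1)),
    integral_map hS.aemeasurable] at hmain
  · exact hmain
  · have hP := Measure.isProbabilityMeasure_map (μ := P) hS.aemeasurable
    exact (integrable_trimming_gain n0 m hα _).aestronglyMeasurable
end

section
/- Let n ≥ 1, let s_1, …, s_{n+1} ∈ ℝ be pairwise distinct, let y_1, …, y_{n+1} ∈ {0,1} with y_{n+1} = 0, and let 0 ≤ m ≤ n. Let D^LT be the label-trimmed set obtained from the scores s_1, …, s_n with labels y_1, …, y_n and budget m, and let D̃ be the label-trimmed set obtained from the scores s_1, …, s_{n+1} with labels y_1, …, y_{n+1} and budget m+1. Then n+1 ∈ D̃, and D̃ \ {n+1} either equals D^LT, or equals D^LT \ {j} for exactly one index j ∈ D^LT with y_j = 1 (the latter occurring precisely when s_{n+1} is not among the m+1 largest of s_1, …, s_{n+1} and the index j attaining the (m+1)-th largest of s_1, …, s_n has y_j = 1). In particular, |D̃ \ {n+1}| ∈ {|D^LT|, |D^LT| − 1}. -/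
/-- Label-trim: given scores `s`, labels `y` (`y i = 0` marks an inlier,
`y i = 1` an outlier), a budget `b`, and a base set `D`, annotate the `b`
indices of `D` with the largest scores (i.e. those `i ∈ D` with at most `b`
indices `j ∈ D` satisfying `s j ≥ s i`; for pairwise distinct scores these are
exactly the top `b`) and remove the annotated outliers: keep `i ∈ D` iff `i`
is not annotated or `y i = 0`. -/
noncomputable def labelTrim {N : ℕ} (s : Fin N → ℝ) (y : Fin N → ℕ) (b : ℕ)
    (D : Finset (Fin N)) : Finset (Fin N) :=
  D.filter fun i => b < (D.filter fun j => s i ≤ s j).card ∨ y i = 0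

/-- The upper rank within `D` strictly increases when the score drops to that of a point of `D`. -/
lemma card_filter_score_le_lt {ι : Type*} {s : ι → ℝ} {D : Finset ι} {i j : ι}
    (hj : j ∈ D) (hji : s j < s i) :
    (D.filter fun k => s i ≤ s k).card < (D.filter fun k => s j ≤ s k).card := by
  refine Finset.card_lt_card (Finset.ssubset_iff_of_subset ?_ |>.2 ⟨j, by simp [hj], by simp [hji]⟩)
  exact Finset.monotone_filter_right D fun k _ hk => hji.le.trans hk

/-- For injective scores, the upper rank is injective on `D`. -/
lemma eq_of_card_filter_score_le_eq {ι : Type*} {s : ι → ℝ} (hs : Function.Injective s)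
    {D : Finset ι} {i j : ι} (hi : i ∈ D) (hj : j ∈ D)
    (h : (D.filter fun k => s i ≤ s k).card = (D.filter fun k => s j ≤ s k).card) : i = j := by
  by_contra hne
  rcases lt_or_gt_of_ne (hs.ne hne) with hlt | hlt
  · exact absurd h (card_filter_score_le_lt hi hlt).ne'
  · exact absurd h (card_filter_score_le_lt hj hlt).ne

/-- Adding the index `a` to the base set raises the upper rank at level `c` by one exactly when
`c ≤ s a`. -/
lemma card_filter_le_eq_erase_add {ι : Type*} [Fintype ι] [DecidableEq ι] (s : ι → ℝ) (a : ι)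
    (c : ℝ) :
    (Finset.univ.filter fun k => c ≤ s k).card =
      ((Finset.univ.erase a).filter fun k => c ≤ s k).card + if c ≤ s a then 1 else 0 := by
  conv_lhs => rw [← Finset.insert_erase (Finset.mem_univ a), Finset.filter_insert]
  split_ifs with h
  · rw [Finset.card_insert_of_notMem (by simp)]
  · rfl

/-- Away from `a`, enlarging the base set by `a` and the budget by one removes exactly the outliers
of upper rank `m + 1` that score above `a`. -/
lemma mem_erase_labelTrim_univ_iff {N : ℕ} {s : Fin N → ℝ} (hs : Function.Injective s)
    {y : Fin N → ℕ} (hy : ∀ i, y i = 0 ∨ y i = 1) (m : ℕ) (a i : Fin N) :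
    i ∈ (labelTrim s y (m + 1) Finset.univ).erase a ↔
      i ∈ labelTrim s y m (Finset.univ.erase a) ∧
        ¬ (((Finset.univ.erase a).filter fun k => s i ≤ s k).card = m + 1 ∧ y i = 1 ∧
          s a < s i) := by
  by_cases hia : i = a
  · simp [hia, labelTrim]
  have hyi := hy i
  have hcard := card_filter_le_eq_erase_add s a (s i)
  simp only [labelTrim, Finset.mem_erase, Finset.mem_filter, Finset.mem_univ, true_and, and_true,
    ne_eq, hia, not_false_eq_true]
  rcases lt_or_gt_of_ne (hs.ne hia) with hlt | hlt
  · rw [if_pos hlt.le] at hcard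
    have hn := hlt.not_gt
    rw [hcard]
    simp [hn]
  · rw [if_neg hlt.not_ge] at hcard
    rw [hcard]
    simp only [hlt, and_true]
    omega

/-- A point of upper rank `m + 1` among the indices other than `a` scores above `a` iff `a` is not
among the `m + 1` largest of all scores. -/
lemma lt_score_iff_lt_card {N : ℕ} {s : Fin N → ℝ} (hs : Function.Injective s)
    {m : ℕ} {a j : Fin N} (hja : j ≠ a)
    (hj : ((Finset.univ.erase a).filter fun k => s j ≤ s k).card = m + 1) :
    s a < s j ↔ m + 1 < (Finset.univ.filter fun k => s a ≤ s k).card := by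
  have hcard := card_filter_le_eq_erase_add s a (s j)
  rcases lt_or_gt_of_ne (hs.ne hja) with hlt | hlt
  · have h := card_filter_score_le_lt (Finset.mem_univ j) hlt
    rw [if_pos hlt.le] at hcard
    exact iff_of_false hlt.not_gt (by omega)
  · have h := card_filter_score_le_lt (Finset.mem_univ a) hlt
    rw [if_neg hlt.not_ge] at hcard
    exact iff_of_true hlt (by omega)

/-- case analysis from the proof of Theorem 4.1, Appendix
A.3.2.  Let `s 0, …, s n` be pairwise distinct scores with labels
`y i ∈ {0,1}` and `y (Fin.last n) = 0` (the test point is an inlier), and let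
`0 ≤ m ≤ n`.  Let `D^LT` be the label-trimmed set of the `n` calibration
scores with budget `m`, and `D̃` the label-trimmed set of all `n+1` scores
with budget `m+1` (the "mirror" procedure).  Then the test index lies in `D̃`,
and `D̃ \ {n+1}` either equals `D^LT` or equals `D^LT \ {j}` for exactly one
`j ∈ D^LT` with `y j = 1`; the latter occurs precisely when `s (n+1)` is not
among the `m+1` largest of all scores and the index attaining the `(m+1)`-th
largest calibration score is labeled `1`.  In particular
`|D̃ \ {n+1}| ∈ {|D^LT|, |D^LT| − 1}`. -/
theorem mirror_trim_cases
    (n : ℕ) (hn : 1 ≤ n) (s : Fin (n + 1) → ℝ) (hs : Function.Injective s)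
    (y : Fin (n + 1) → ℕ) (hy : ∀ i, y i = 0 ∨ y i = 1) (hylast : y (Fin.last n) = 0)
    (m : ℕ) (hm : m ≤ n) :
    Fin.last n ∈ labelTrim s y (m + 1) Finset.univ ∧
    ((labelTrim s y (m + 1) Finset.univ).erase (Fin.last n)
        = labelTrim s y m (Finset.univ.erase (Fin.last n)) ∨
      ∃! j, j ∈ labelTrim s y m (Finset.univ.erase (Fin.last n)) ∧ y j = 1 ∧
        (labelTrim s y (m + 1) Finset.univ).erase (Fin.last n)
          = (labelTrim s y m (Finset.univ.erase (Fin.last n))).erase j) ∧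
    ((∃ j, j ∈ labelTrim s y m (Finset.univ.erase (Fin.last n)) ∧ y j = 1 ∧
        (labelTrim s y (m + 1) Finset.univ).erase (Fin.last n)
          = (labelTrim s y m (Finset.univ.erase (Fin.last n))).erase j)
      ↔ (m + 1 < (Finset.univ.filter fun k => s (Fin.last n) ≤ s k).card ∧
          ∃ j ∈ Finset.univ.erase (Fin.last n),
            ((Finset.univ.erase (Fin.last n)).filter fun k => s j ≤ s k).card = m + 1 ∧
            y j = 1)) ∧
    (((labelTrim s y (m + 1) Finset.univ).erase (Fin.last n)).card
        = (labelTrim s y m (Finset.univ.erase (Fin.last n))).card ∨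
      ((labelTrim s y (m + 1) Finset.univ).erase (Fin.last n)).card
        = (labelTrim s y m (Finset.univ.erase (Fin.last n))).card - 1) := by
  have hmem := mem_erase_labelTrim_univ_iff hs hy m (Fin.last n)
  have hrank {j : Fin (n + 1)} := lt_score_iff_lt_card hs (m := m) (a := Fin.last n) (j := j)
  have hlast : Fin.last n ∈ labelTrim s y (m + 1) Finset.univ := by simp [labelTrim, hylast]
  have hD : ∀ j, j ∈ labelTrim s y m (Finset.univ.erase (Fin.last n)) ↔ j ≠ Fin.last n ∧
      (m < ((Finset.univ.erase (Fin.last n)).filter fun k => s j ≤ s k).card ∨ y j = 0) := by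
    simp [labelTrim]
  have huniq : ∀ i j, i ≠ Fin.last n → j ≠ Fin.last n →
      ((Finset.univ.erase (Fin.last n)).filter fun k => s i ≤ s k).card = m + 1 →
      ((Finset.univ.erase (Fin.last n)).filter fun k => s j ≤ s k).card = m + 1 → i = j :=
    fun i j hi hj h h' => eq_of_card_filter_score_le_eq hs (by simpa using hi) (by simpa using hj)
      (h.trans h'.symm)
  generalize (labelTrim s y (m + 1) Finset.univ).erase (Fin.last n) = E at *
  generalize labelTrim s y m (Finset.univ.erase (Fin.last n)) = D at *
  have hremoved : ∀ j ∈ D, E = D.erase j →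
      ((Finset.univ.erase (Fin.last n)).filter fun k => s j ≤ s k).card = m + 1 ∧ y j = 1 ∧
        s (Fin.last n) < s j := by
    intro j hj hE
    by_contra hP
    have hjE := (hmem j).2 ⟨hj, hP⟩
    simp [hE] at hjE
  have herase : ∀ j, j ≠ Fin.last n →
      ((Finset.univ.erase (Fin.last n)).filter fun k => s j ≤ s k).card = m + 1 → y j = 1 →
      s (Fin.last n) < s j → j ∈ D ∧ y j = 1 ∧ E = D.erase j := by
    intro j hj hjm hyj hlt
    refine ⟨(hD j).2 ⟨hj, Or.inl (by omega)⟩, hyj, ?_⟩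
    ext i
    rw [hmem, Finset.mem_erase, and_comm]
    refine and_congr_left fun hi => not_congr ⟨fun h => ?_, ?_⟩
    · exact huniq i j ((hD i).1 hi).1 hj h.1 hjm
    · rintro rfl
      exact ⟨hjm, hyj, hlt⟩
  have hcases : E = D ∨ ∃! j, j ∈ D ∧ y j = 1 ∧ E = D.erase j := by
    by_cases h : ∃ j, j ∈ D ∧
        ((Finset.univ.erase (Fin.last n)).filter fun k => s j ≤ s k).card = m + 1 ∧ y j = 1 ∧
          s (Fin.last n) < s j
    · obtain ⟨j, hj, hjm, hyj, hlt⟩ := h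
      have hjl := ((hD j).1 hj).1
      refine Or.inr ⟨j, herase j hjl hjm hyj hlt, fun i hi => ?_⟩
      exact huniq i j ((hD i).1 hi.1).1 hjl (hremoved i hi.1 hi.2.2).1 hjm
    · refine Or.inl (Finset.ext fun i => ?_)
      rw [hmem]
      exact and_iff_left_of_imp fun hi hP => h ⟨i, hi, hP⟩
  refine ⟨hlast, hcases, ⟨?_, ?_⟩, ?_⟩
  · rintro ⟨j, hj, hyj, hE⟩
    obtain ⟨hjm, -, hlt⟩ := hremoved j hj hE
    have hjl := ((hD j).1 hj).1
    exact ⟨(hrank hjl hjm).1 hlt, j, by simpa using hjl, hjm, hyj⟩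
  · rintro ⟨hlt, j, hj, hjm, hyj⟩
    have hjl := Finset.ne_of_mem_erase hj
    exact ⟨j, herase j hjl hjm hyj ((hrank hjl hjm).2 hlt)⟩
  · rcases hcases with h | ⟨j, ⟨hj, -, h⟩, -⟩
    · exact Or.inl (by rw [h])
    · exact Or.inr (by rw [h, Finset.card_erase_of_mem hj])
end
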